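/- Let n, m be positive integers and k a weight vector. Suppose k₁ = max_{1≤i≤n} k_i, let Θ ∈ Bad(k,n,m), let C ⊂ ℝⁿ be an everywhere non-degenerate C¹ curve, and let π : ℝⁿ → ℝ be the projection onto the first coordinate. Then the Hausdorff dimension of π(Bad_Θ(k,n,m) ∩ C) equals 1. -/

import Mathlib

open Real MeasureTheory Topology

/-- Distance from a real number to the nearest integer. -/
noncomputable def distNearestInt (y : ℝ) : ℝ := ⨅ p : ℤ, |y - (p : ℝ)|

/-- `Θᵢ(q) = ∑ⱼ qⱼ Θᵢⱼ` : the `i`-th linear form of `Θ` evaluated at `q ∈ ℤᵐ`. -/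
noncomputable def linForm {n m : ℕ} (Θ : Matrix (Fin n) (Fin m) ℝ) (q : Fin m → ℤ)
    (i : Fin n) : ℝ := ∑ j, (q j : ℝ) * Θ i j

/-- `Θ*ⱼ(u) = ∑ᵢ uᵢ Θᵢⱼ` : the `j`-th linear form of the transposed matrix `Θ*`. -/
noncomputable def dualForm {n m : ℕ} (Θ : Matrix (Fin n) (Fin m) ℝ) (u : Fin n → ℤ)
    (j : Fin m) : ℝ := ∑ i, (u i : ℝ) * Θ i j

/-- The supremum norm `|q|` of an integer vector. -/
noncomputable def supNorm {m : ℕ} (q : Fin m → ℤ) : ℝ := ⨆ j, |(q j : ℝ)|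

/-- A weight vector: positive entries summing to 1. -/
def IsWeight {n : ℕ} (k : Fin n → ℝ) : Prop := (∀ i, 0 < k i) ∧ ∑ i, k i = 1

/-- The set `Bad(k,n,m)` of weighted badly approximable `n × m` matrices:
`inf_{q ∈ ℤᵐ, q ≠ 0} max_{1≤i≤n} |q|^{m kᵢ} ‖Θᵢ(q)‖ > 0`. -/
def Bad (n m : ℕ) (k : Fin n → ℝ) : Set (Matrix (Fin n) (Fin m) ℝ) :=
  {Θ | ∃ c > 0, ∀ q : Fin m → ℤ, q ≠ 0 →
    c ≤ ⨆ i, supNorm q ^ ((m : ℝ) * k i) * distNearestInt (linForm Θ q i)}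

/-- The twisted set `Bad_Θ(k,n,m)`:
`{x ∈ ℝⁿ : inf_{q ∈ ℤᵐ, q ≠ 0} max_{1≤i≤n} |q|^{m kᵢ} ‖Θᵢ(q) − xᵢ‖ > 0}`. -/
def BadT (n m : ℕ) (k : Fin n → ℝ) (Θ : Matrix (Fin n) (Fin m) ℝ) : Set (Fin n → ℝ) :=
  {x | ∃ c > 0, ∀ q : Fin m → ℤ, q ≠ 0 →
    c ≤ ⨆ i, supNorm q ^ ((m : ℝ) * k i) * distNearestInt (linForm Θ q i - x i)}

/-- Minkowski's theorem on linear forms. -/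
theorem exists_int_ne_zero_abs_mulVec_lt {ι : Type*} [Fintype ι] [DecidableEq ι]
    (A : Matrix ι ι ℝ) (hA : A.det ≠ 0) (ε : ι → ℝ) (hε : ∀ i, 0 < ε i)
    (h : |A.det| < ∏ i, ε i) :
    ∃ z : ι → ℤ, z ≠ 0 ∧ ∀ i, |A.mulVec (fun j => (z j : ℝ)) i| < ε i := by
  set s : Set (ι → ℝ) := Matrix.toLin' A ⁻¹' Set.univ.pi fun i => Set.Ioo (-ε i) (ε i) with hs
  have hconv : Convex ℝ s :=
    (convex_pi fun i _ => convex_Ioo _ _).linear_preimage _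
  have hsymm : ∀ x ∈ s, -x ∈ s := by
    intro x hx i hi
    have := hx i hi
    simp only [map_neg, Pi.neg_apply, Set.mem_Ioo] at this ⊢
    constructor <;> linarith [this.1, this.2]
  have hvol : volume s = ENNReal.ofReal (|A.det|⁻¹ * ∏ i, (2 * ε i)) := by
    rw [hs, Measure.addHaar_preimage_linearMap _ (by rwa [LinearMap.det_toLin']),
      Real.volume_pi_Ioo, LinearMap.det_toLin', ENNReal.ofReal_mul (by positivity),
      ENNReal.ofReal_prod_of_nonneg fun i _ => by have := hε i; positivity, abs_inv]
    congr 2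
    ext i
    ring_nf
  have hfund := ZSpan.isAddFundamentalDomain' (Pi.basisFun ℝ ι) volume
  have : Countable (Submodule.span ℤ (Set.range (Pi.basisFun ℝ ι))).toAddSubgroup :=
    inferInstanceAs (Countable (Submodule.span ℤ (Set.range (Pi.basisFun ℝ ι))))
  obtain ⟨x, hx0, hxs⟩ := exists_ne_zero_mem_lattice_of_measure_mul_two_pow_lt_measure
    hfund hsymm hconv (by
      rw [hvol, ZSpan.fundamentalDomain_pi_basisFun, Real.volume_pi_Ico]
      simp only [sub_zero, ENNReal.ofReal_one, Finset.prod_const_one, one_mul,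
        Module.finrank_fintype_fun_eq_card]
      rw [Finset.prod_mul_distrib, Finset.prod_const, Finset.card_univ,
        show (2 : ENNReal) ^ Fintype.card ι = ENNReal.ofReal (2 ^ Fintype.card ι) by
          simp [ENNReal.ofReal_pow]]
      have hA' := abs_pos.2 hA
      refine (ENNReal.ofReal_lt_ofReal_iff_of_nonneg (by positivity)).2 ?_
      rw [inv_mul_eq_div, lt_div_iff₀ hA']
      gcongr)
  have hmem := ((Pi.basisFun ℝ ι).mem_span_iff_repr_mem ℤ (x : ι → ℝ)).1 x.2
  choose z hz using hmem
  have hzx : (fun j => (z j : ℝ)) = x := by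
    ext j
    simpa using hz j
  refine ⟨z, ?_, fun i => ?_⟩
  · rintro rfl
    apply hx0
    ext j
    simpa using (hz j).symm
  · rw [hzx]
    have := hxs i (Set.mem_univ i)
    simpa [abs_lt] using this

/-- Transference: if the integer vectors of the dual lattice stay away from the origin, then so do
those of the lattice itself. -/
theorem exists_le_abs_mulVec_of_dual {ι : Type*} [Fintype ι] [DecidableEq ι]
    (A A' : Matrix ι ι ℝ) (hAA' : A.transpose * A' = 1) (hdet : |A'.det| = 1) {δ : ℝ} (hδ : 0 < δ)
    (h : ∀ w : ι → ℤ, w ≠ 0 → ∃ i, Fintype.card ι * δ < |A'.mulVec (fun j => (w j : ℝ)) i|)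
    (z : ι → ℤ) (hz : z ≠ 0) :
    ∃ i, δ ^ (Fintype.card ι - 1) ≤ |A.mulVec (fun j => (z j : ℝ)) i| := by
  by_contra! hcon
  set v := A.mulVec (fun j => (z j : ℝ)) with hv
  have hA'A : A'.transpose * A = 1 := by
    have := congrArg Matrix.transpose hAA'
    simpa using this
  have hne : Nonempty ι := by
    by_contra hne
    rw [not_nonempty_iff] at hne
    exact hz (Subsingleton.elim _ _)
  obtain ⟨a, ha⟩ := Finite.exists_max fun i => |v i|
  have hva : 0 < |v a| := by
    by_contra! h0
    have hv0 : v = 0 := by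
      ext i
      exact abs_nonpos_iff.1 ((ha i).trans h0)
    have h1 : (fun j => (z j : ℝ)) = 0 := by
      rw [← Matrix.one_mulVec (fun j => (z j : ℝ)), ← hA'A, ← Matrix.mulVec_mulVec, ← hv, hv0,
        Matrix.mulVec_zero]
    apply hz
    ext j
    simpa using congrFun h1 j
  set R := A'.updateRow a (∑ k, v k • A' k) with hR
  have hRdet : |R.det| = |v a| := by
    rw [hR, Matrix.det_updateRow_sum, smul_eq_mul, abs_mul, hdet, mul_one]
  obtain ⟨w, hw0, hw⟩ := exists_int_ne_zero_abs_mulVec_lt R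
    (by rw [← abs_pos, hRdet]; exact hva) (Function.update (fun _ => δ) a 1)
    (by intro i; by_cases hi : i = a
        · subst hi; simp
        · simp [hi, hδ])
    (by
      rw [hRdet, Finset.prod_update_of_mem (Finset.mem_univ a), one_mul, Finset.prod_const,
        Finset.card_sdiff]
      simpa using hcon a)
  set ξ := A'.mulVec (fun j => (w j : ℝ)) with hξ
  have hξi : ∀ i, i ≠ a → |ξ i| < δ := by
    intro i hi
    have := hw i
    simpa [hR, Matrix.mulVec, hi, hξ] using this
  have hpair : v ⬝ᵥ ξ = ((z ⬝ᵥ w : ℤ) : ℝ) := by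
    rw [hv, hξ, Matrix.dotProduct_mulVec, Matrix.vecMul_mulVec, ← Matrix.dotProduct_mulVec, hAA',
      Matrix.one_mulVec]
    simp [dotProduct]
  have hva1 : |v ⬝ᵥ ξ| < 1 := by
    have := hw a
    rw [hR] at this
    simp only [Matrix.mulVec, Matrix.updateRow_self, Function.update_self] at this
    convert this using 2
    simp only [hξ, Matrix.mulVec, dotProduct, Finset.sum_apply, Pi.smul_apply, smul_eq_mul,
      Finset.mul_sum, Finset.sum_mul]
    rw [Finset.sum_comm]
    simp only [mul_assoc]
  have h0 : v ⬝ᵥ ξ = 0 := by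
    rw [hpair] at hva1 ⊢
    have : |z ⬝ᵥ w| < 1 := by exact_mod_cast hva1
    rw [Int.abs_lt_one_iff.1 this, Int.cast_zero]
  have hξa : |ξ a| ≤ Fintype.card ι * δ := by
    have h1 : v a * ξ a = -∑ i ∈ Finset.univ.erase a, v i * ξ i := by
      have := Finset.add_sum_erase Finset.univ (fun i => v i * ξ i) (Finset.mem_univ a)
      rw [dotProduct] at h0
      linarith
    have h2 : |v a| * |ξ a| ≤ |v a| * (Fintype.card ι * δ) := by
      rw [← abs_mul, h1, abs_neg]
      calc |∑ i ∈ Finset.univ.erase a, v i * ξ i|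
          ≤ ∑ i ∈ Finset.univ.erase a, |v i * ξ i| := Finset.abs_sum_le_sum_abs _ _
        _ ≤ ∑ i ∈ Finset.univ.erase a, |v a| * δ := by
            refine Finset.sum_le_sum fun i hi => ?_
            rw [abs_mul]
            exact mul_le_mul (ha i) (hξi i (Finset.ne_of_mem_erase hi)).le (abs_nonneg _)
              (abs_nonneg _)
        _ ≤ ∑ i : ι, |v a| * δ :=
            Finset.sum_le_sum_of_subset_of_nonneg (Finset.erase_subset _ _)
              fun _ _ _ => by positivity
        _ = _ := by simp; ring
    exact le_of_mul_le_mul_left h2 hva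
  obtain ⟨i, hi⟩ := h w hw0
  have hcard : (1 : ℝ) ≤ Fintype.card ι := by exact_mod_cast Fintype.card_pos
  by_cases hia : i = a
  · subst hia
    exact absurd hξa (not_le.2 hi)
  · have := hξi i hia
    change _ < |ξ i| at hi
    nlinarith

/-- Lower bound for the Hausdorff dimension of a set containing a Cantor-type set: every interval
of length `ℓ / B ^ t` contains `N` well separated subintervals of length `ℓ / B ^ (t + 1)`
inside `G t`. -/
theorem le_dimH_of_separated_children (N : ℕ) (hN : 2 ≤ N) (B : ℝ) (hB : 1 < B) (l : ℝ)
    (hl : 0 < l) (x₀ : ℝ) (G : ℕ → Set ℝ)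
    (h : ∀ (t : ℕ) (x : ℝ), Set.Icc x (x + l / B ^ t) ⊆ Set.Icc x₀ (x₀ + l) →
      ∃ y : Fin N → ℝ,
        (∀ i, Set.Icc (y i) (y i + l / B ^ (t + 1)) ⊆ Set.Icc x (x + l / B ^ t) ∩ G t) ∧
        ∀ i j, i ≠ j → 2 * (l / B ^ (t + 1)) ≤ |y i - y j|) :
    ENNReal.ofReal (Real.log N / Real.log B) ≤ dimH (Set.Icc x₀ (x₀ + l) ∩ ⋂ t, G t) := by
  have hB0 : 0 < B := by linarith
  have hN1 : (1 : ℝ) < N := by exact_mod_cast hN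
  choose! y hy using h
  let X : (ℕ → Fin N) → ℕ → ℝ := fun d t => Nat.rec x₀ (fun t x => y t x (d t)) t
  have X0 : ∀ d, X d 0 = x₀ := fun d => rfl
  have Xs : ∀ d t, X d (t + 1) = y t (X d t) (d t) := fun d t => rfl
  have lpos : ∀ t : ℕ, 0 < l / B ^ t := fun t => by positivity
  have hsub : ∀ d t, Set.Icc (X d t) (X d t + l / B ^ t) ⊆ Set.Icc x₀ (x₀ + l) := by
    intro d t
    induction t with
    | zero => simp [X0]
    | succ t ih =>
      rw [Xs]
      exact (((hy t _ ih).1 (d t)).trans Set.inter_subset_left).trans ih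
  have hstep : ∀ d t, Set.Icc (X d (t + 1)) (X d (t + 1) + l / B ^ (t + 1)) ⊆
      Set.Icc (X d t) (X d t + l / B ^ t) ∩ G t := by
    intro d t
    rw [Xs]
    exact (hy t _ (hsub d t)).1 (d t)
  have hφ : ∀ d, ∃ p, ∀ t, p ∈ Set.Icc (X d t) (X d t + l / B ^ t) := by
    intro d
    have := IsCompact.nonempty_iInter_of_sequence_nonempty_isCompact_isClosed
      (fun t => Set.Icc (X d t) (X d t + l / B ^ t))
      (fun t => (hstep d t).trans Set.inter_subset_left)
      (fun t => Set.nonempty_Icc.2 (by linarith [lpos t])) isCompact_Icc (fun t => isClosed_Icc)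
    obtain ⟨p, hp⟩ := this
    exact ⟨p, Set.mem_iInter.1 hp⟩
  choose φ hφ using hφ
  have hsep : ∀ d d' t, (∀ s < t, d s = d' s) → d t ≠ d' t →
      l / B ^ (t + 1) ≤ |φ d - φ d'| := by
    intro d d' t hlt hne
    have hX : ∀ s ≤ t, X d s = X d' s := by
      intro s hs
      induction s with
      | zero => rfl
      | succ s ih => rw [Xs, Xs, ih (by omega), hlt s (by omega)]
    have h1 := (hy t _ (hsub d t)).2 _ _ hne
    have h2 := hφ d (t + 1)
    have h3 := hφ d' (t + 1)
    rw [Xs] at h2 h3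
    rw [← hX t le_rfl] at h3
    obtain ⟨h2, h2'⟩ := h2
    obtain ⟨h3, h3'⟩ := h3
    rcases le_abs.1 h1 with h1 | h1
    · exact le_abs.2 (Or.inl (by linarith))
    · exact le_abs.2 (Or.inr (by linarith))
  have hfirst : ∀ d d' : ℕ → Fin N, d ≠ d' → ∃ t, (∀ s < t, d s = d' s) ∧ d t ≠ d' t := by
    intro d d' hne
    have hex : ∃ t, d t ≠ d' t := Function.ne_iff.1 hne
    classical
    exact ⟨Nat.find hex, fun s hs => not_not.1 (Nat.find_min hex hs), Nat.find_spec hex⟩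
  have hinj : Function.Injective φ := by
    intro d d' hdd
    by_contra hne
    obtain ⟨t, ht, ht'⟩ := hfirst d d' hne
    have := hsep d d' t ht ht'
    rw [hdd, sub_self, abs_zero] at this
    exact absurd this (not_le.2 (lpos _))
  have : Nonempty (ℕ → Fin N) := ⟨fun _ => ⟨0, by omega⟩⟩
  have hlogB : 0 < Real.log B := Real.log_pos hB
  have hlogN : 0 < Real.log N := Real.log_pos hN1
  set r : NNReal := (Real.log N / Real.log B).toNNReal with hr
  have hr0 : 0 < r := Real.toNNReal_pos.2 (by positivity)
  have hrval : (r : ℝ) = Real.log N / Real.log B := Real.coe_toNNReal _ (by positivity)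
  have hBr : B ^ (r : ℝ) = N := by
    rw [Real.rpow_def_of_pos hB0, hrval, mul_div_cancel₀ _ hlogB.ne', Real.exp_log (by linarith)]
  set ψ : ℝ → ℝ := fun x => Real.ofDigits (Function.invFun φ x) with hψ
  have hψφ : ∀ d, ψ (φ d) = Real.ofDigits d := fun d => by
    simp only [hψ, Function.leftInverse_invFun hinj d]
  set C : NNReal := (N * l ^ (-(r : ℝ))).toNNReal with hC
  have hCval : (C : ℝ) = N * l ^ (-(r : ℝ)) := Real.coe_toNNReal _ (by positivity)
  have hhold : HolderOnWith C r ψ (Set.range φ) := by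
    rintro _ ⟨d, rfl⟩ _ ⟨d', rfl⟩
    by_cases hne : d = d'
    · simp [hne]
    obtain ⟨t, ht, ht'⟩ := hfirst d d' hne
    have h1 := hsep d d' t ht ht'
    have h2 := Real.abs_ofDigits_sub_ofDigits_le ht
    rw [hψφ, hψφ, edist_dist, edist_dist, Real.dist_eq, Real.dist_eq,
      ENNReal.ofReal_rpow_of_nonneg (abs_nonneg _) r.coe_nonneg, ← ENNReal.ofReal_coe_nnreal,
      ← ENNReal.ofReal_mul C.coe_nonneg]
    refine ENNReal.ofReal_le_ofReal (h2.trans ?_)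
    rw [hCval]
    calc ((N : ℝ) ^ t)⁻¹ = N * l ^ (-(r : ℝ)) * (l / B ^ (t + 1)) ^ (r : ℝ) := by
          rw [Real.div_rpow hl.le (by positivity), ← Real.rpow_natCast B, ← Real.rpow_mul hB0.le,
            mul_comm ((t + 1 : ℕ) : ℝ), Real.rpow_mul hB0.le, hBr, Real.rpow_natCast,
            Real.rpow_neg hl.le]
          have := Real.rpow_pos_of_pos hl r
          field_simp
          ring
      _ ≤ _ := by gcongr
  have himg : ψ '' Set.range φ = Set.Icc 0 1 := by
    apply Set.Subset.antisymm
    · rintro _ ⟨_, ⟨d, rfl⟩, rfl⟩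
      rw [hψφ]
      exact ⟨Real.ofDigits_nonneg d, Real.ofDigits_le_one d⟩
    · intro x hx
      obtain ⟨d, -, rfl⟩ := Real.ofDigits_SurjOn (b := N) (by omega) hx
      exact ⟨φ d, ⟨d, rfl⟩, hψφ d⟩
  have hdim := hhold.dimH_image_le hr0
  rw [himg, Real.dimH_of_nonempty_interior (by simp), Module.finrank_self, Nat.cast_one,
    ENNReal.le_div_iff_mul_le (Or.inl (by exact_mod_cast hr0.ne')) (Or.inl ENNReal.coe_ne_top),
    one_mul] at hdim
  refine le_trans (le_of_eq rfl) (hdim.trans (dimH_mono ?_))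
  rintro _ ⟨d, rfl⟩
  refine ⟨by simpa [X0] using hφ d 0, Set.mem_iInter.2 fun t => ?_⟩
  exact (hstep d t (hφ d (t + 1))).2

theorem distNearestInt_le_abs_sub (y : ℝ) (p : ℤ) : distNearestInt y ≤ |y - p| :=
  ciInf_le ⟨0, by rintro _ ⟨p, rfl⟩; exact abs_nonneg _⟩ p

theorem distNearestInt_eq_abs_sub_round (y : ℝ) : distNearestInt y = |y - round y| :=
  le_antisymm (distNearestInt_le_abs_sub y _) (le_ciInf fun p => round_le y p)

theorem abs_le_supNorm {m : ℕ} (q : Fin m → ℤ) (j : Fin m) : |(q j : ℝ)| ≤ supNorm q :=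
  le_ciSup (f := fun j => |(q j : ℝ)|) (Set.finite_range _).bddAbove j

theorem one_le_supNorm {m : ℕ} {q : Fin m → ℤ} (hq : q ≠ 0) : 1 ≤ supNorm q := by
  obtain ⟨j, hj⟩ := Function.ne_iff.1 hq
  refine le_trans ?_ (abs_le_supNorm q j)
  exact_mod_cast Int.one_le_abs hj

/-- The matrix of the forms `Q ^ (-m kᵢ) uᵢ` and `Q (Θ*ⱼ(u) - pⱼ)` in the variables `(u, p)`. -/
noncomputable def transposedFormsMatrix {n m : ℕ} (k : Fin n → ℝ) (Θ : Matrix (Fin n) (Fin m) ℝ)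
    (Q : ℝ) : Matrix (Fin n ⊕ Fin m) (Fin n ⊕ Fin m) ℝ :=
  Matrix.fromBlocks (Matrix.diagonal fun i => (Q ^ ((m : ℝ) * k i))⁻¹) 0
    (Matrix.of fun j i => Q * Θ i j) (Matrix.diagonal fun _ => -Q)

/-- The matrix of the forms `Q ^ (m kᵢ) (Θᵢ(q) + pᵢ)` and `-qⱼ / Q` in the variables `(p, q)`. -/
noncomputable def formsMatrix {n m : ℕ} (k : Fin n → ℝ) (Θ : Matrix (Fin n) (Fin m) ℝ)
    (Q : ℝ) : Matrix (Fin n ⊕ Fin m) (Fin n ⊕ Fin m) ℝ :=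
  Matrix.fromBlocks (Matrix.diagonal fun i => Q ^ ((m : ℝ) * k i))
    (Matrix.of fun i j => Q ^ ((m : ℝ) * k i) * Θ i j) 0 (Matrix.diagonal fun _ => -Q⁻¹)

section FormsMatrix

variable {n m : ℕ} {k : Fin n → ℝ} {Θ : Matrix (Fin n) (Fin m) ℝ} {Q : ℝ}

theorem transpose_transposedFormsMatrix_mul_formsMatrix (hQ : 0 < Q) :
    (transposedFormsMatrix k Θ Q).transpose * formsMatrix k Θ Q = 1 := by
  have h : ∀ i, Q ^ ((m : ℝ) * k i) ≠ 0 := fun i => (Real.rpow_pos_of_pos hQ _).ne'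
  rw [transposedFormsMatrix, formsMatrix, Matrix.fromBlocks_transpose, Matrix.fromBlocks_multiply,
    ← Matrix.fromBlocks_one]
  congr 1
  · ext i i'
    simp [Matrix.one_apply, h]
  · ext i j
    simp only [Matrix.diagonal_transpose, Matrix.add_apply, Matrix.diagonal_mul, Matrix.of_apply,
      Matrix.mul_diagonal, Matrix.transpose_apply, Matrix.zero_apply]
    have := h i
    field_simp
    ring
  · simp
  · ext j j'
    simp [Matrix.one_apply, hQ.ne']

theorem abs_det_formsMatrix (hk : IsWeight k) (hQ : 0 < Q) : |(formsMatrix k Θ Q).det| = 1 := by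
  rw [formsMatrix, Matrix.det_fromBlocks_zero₂₁, Matrix.det_diagonal, Matrix.det_diagonal,
    ← Real.rpow_sum_of_pos hQ, ← Finset.mul_sum, hk.2, mul_one, Real.rpow_natCast]
  simp [abs_mul, abs_of_pos hQ, hQ.ne']

theorem abs_det_transposedFormsMatrix (hk : IsWeight k) (hQ : 0 < Q) :
    |(transposedFormsMatrix k Θ Q).det| = 1 := by
  have := congrArg (fun M => |Matrix.det M|)
    (transpose_transposedFormsMatrix_mul_formsMatrix (k := k) (Θ := Θ) hQ)
  simpa [abs_mul, abs_det_formsMatrix hk hQ] using this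

theorem formsMatrix_mulVec_inl (w : Fin n ⊕ Fin m → ℤ) (i : Fin n) :
    (formsMatrix k Θ Q).mulVec (fun a => (w a : ℝ)) (Sum.inl i) =
      Q ^ ((m : ℝ) * k i) * (linForm Θ (fun j => w (Sum.inr j)) i + w (Sum.inl i)) := by
  simp only [formsMatrix, Matrix.mulVec, dotProduct, Fintype.sum_sum_type,
    Matrix.fromBlocks_apply₁₁, Matrix.fromBlocks_apply₁₂, Matrix.diagonal_apply, ite_mul, zero_mul,
    Finset.sum_ite_eq, Finset.mem_univ, if_true, Matrix.of_apply, linForm, mul_add, Finset.mul_sum]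
  rw [add_comm]
  congr 1
  exact Finset.sum_congr rfl fun j _ => by ring

theorem formsMatrix_mulVec_inr (w : Fin n ⊕ Fin m → ℤ) (j : Fin m) :
    (formsMatrix k Θ Q).mulVec (fun a => (w a : ℝ)) (Sum.inr j) = -Q⁻¹ * w (Sum.inr j) := by
  simp [formsMatrix, Matrix.mulVec, dotProduct, Fintype.sum_sum_type, Matrix.diagonal_apply]

theorem transposedFormsMatrix_mulVec_inl (z : Fin n ⊕ Fin m → ℤ) (i : Fin n) :
    (transposedFormsMatrix k Θ Q).mulVec (fun a => (z a : ℝ)) (Sum.inl i) =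
      (Q ^ ((m : ℝ) * k i))⁻¹ * z (Sum.inl i) := by
  simp [transposedFormsMatrix, Matrix.mulVec, dotProduct, Fintype.sum_sum_type,
    Matrix.diagonal_apply]

theorem transposedFormsMatrix_mulVec_inr (z : Fin n ⊕ Fin m → ℤ) (j : Fin m) :
    (transposedFormsMatrix k Θ Q).mulVec (fun a => (z a : ℝ)) (Sum.inr j) =
      Q * (dualForm Θ (fun i => z (Sum.inl i)) j - z (Sum.inr j)) := by
  simp only [transposedFormsMatrix, Matrix.mulVec, dotProduct, Fintype.sum_sum_type,
    Matrix.fromBlocks_apply₂₁, Matrix.fromBlocks_apply₂₂, Matrix.diagonal_apply, ite_mul, zero_mul,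
    Finset.sum_ite_eq, Finset.mem_univ, if_true, Matrix.of_apply, dualForm, mul_sub,
    Finset.mul_sum, neg_mul, ← sub_eq_add_neg]
  congr 1
  exact Finset.sum_congr rfl fun j _ => by ring

theorem exists_lt_abs_formsMatrix_mulVec (hn : 0 < n) (hk : IsWeight k) (hΘ : Θ ∈ Bad n m k) :
    ∃ δ > 0, ∀ Q : ℝ, 1 ≤ Q → ∀ w : Fin n ⊕ Fin m → ℤ, w ≠ 0 →
      ∃ a, δ < |(formsMatrix k Θ Q).mulVec (fun b => (w b : ℝ)) a| := by
  obtain ⟨c, hc, hbad⟩ := hΘ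
  refine ⟨min c 1 / 2, by positivity, fun Q hQ w hw => ?_⟩
  have hQ0 : 0 < Q := by linarith
  by_contra! hcon
  have hδ1 : min c 1 / 2 ≤ 1 / 2 := by linarith [min_le_right c 1]
  have hδc : min c 1 / 2 ≤ c / 2 := by linarith [min_le_left c 1]
  have hpow : ∀ i, 1 ≤ Q ^ ((m : ℝ) * k i) := fun i =>
    Real.one_le_rpow hQ (mul_nonneg (Nat.cast_nonneg _) (hk.1 i).le)
  by_cases hq : (fun j => w (Sum.inr j)) = 0
  · obtain ⟨a, ha⟩ := Function.ne_iff.1 hw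
    rcases a with i | j
    · have h1 := hcon (Sum.inl i)
      rw [formsMatrix_mulVec_inl, hq, abs_mul] at h1
      have h2 : (1 : ℝ) ≤ |(w (Sum.inl i) : ℝ)| := by exact_mod_cast Int.one_le_abs ha
      simp only [linForm, Pi.zero_apply, Int.cast_zero, zero_mul, Finset.sum_const_zero,
        zero_add] at h1
      nlinarith [hpow i, le_abs_self (Q ^ ((m : ℝ) * k i))]
    · exact ha (congrFun hq j)
  · have hnorm : supNorm (fun j => w (Sum.inr j)) ≤ Q := by
      have : Nonempty (Fin m) := ⟨(Function.ne_iff.1 hq).choose⟩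
      refine ciSup_le fun j => ?_
      have h1 := hcon (Sum.inr j)
      rw [formsMatrix_mulVec_inr, abs_mul, abs_neg, abs_inv, abs_of_pos hQ0,
        inv_mul_eq_div, div_le_iff₀ hQ0] at h1
      nlinarith
    have : Nonempty (Fin n) := ⟨⟨0, hn⟩⟩
    obtain ⟨i, hi⟩ := exists_eq_ciSup_of_finite (f := fun i =>
      supNorm (fun j => w (Sum.inr j)) ^ ((m : ℝ) * k i) *
        distNearestInt (linForm Θ (fun j => w (Sum.inr j)) i))
    have h1 := hbad _ hq
    rw [← hi] at h1
    have h2 := hcon (Sum.inl i)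
    rw [formsMatrix_mulVec_inl, abs_mul, abs_of_pos (Real.rpow_pos_of_pos hQ0 _)] at h2
    have h3 := distNearestInt_le_abs_sub (linForm Θ (fun j => w (Sum.inr j)) i) (-w (Sum.inl i))
    rw [Int.cast_neg, sub_neg_eq_add] at h3
    have hs := one_le_supNorm hq
    have h4 : supNorm (fun j => w (Sum.inr j)) ^ ((m : ℝ) * k i) *
        distNearestInt (linForm Θ (fun j => w (Sum.inr j)) i) ≤
        Q ^ ((m : ℝ) * k i) * |linForm Θ (fun j => w (Sum.inr j)) i + w (Sum.inl i)| := by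
      refine (mul_le_mul_of_nonneg_left h3 (by positivity)).trans ?_
      gcongr
      exact mul_nonneg (Nat.cast_nonneg _) (hk.1 i).le
    linarith

/-- For badly approximable `Θ`, good integer approximations to the transposed system exist at every
height, with the coordinate of largest weight dominating the others. -/
theorem exists_dual_approximation (hn : 0 < n) (hk : IsWeight k) (i₀ : Fin n)
    (hk1 : ∀ i, k i ≤ k i₀) (hΘ : Θ ∈ Bad n m k) {η : ℝ} (hη : 0 < η) :
    ∃ c > 0, ∃ C > 0, ∀ Q : ℝ, 1 ≤ Q → ∃ u : Fin n → ℤ,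
      c * Q ^ ((m : ℝ) * k i₀) ≤ |(u i₀ : ℝ)| ∧
      (∀ i, |(u i : ℝ)| ≤ C * Q ^ ((m : ℝ) * k i)) ∧
      (∀ i, i ≠ i₀ → |(u i : ℝ)| ≤ η * |(u i₀ : ℝ)|) ∧
      ∀ j, ∃ p : ℤ, |dualForm Θ u j - p| ≤ C / Q := by
  obtain ⟨δ₀, hδ₀, hδ⟩ := exists_lt_abs_formsMatrix_mulVec hn hk hΘ
  set d := Fintype.card (Fin n ⊕ Fin m) with hd
  have hd0 : 0 < (d : ℝ) := by
    have : Nonempty (Fin n ⊕ Fin m) := ⟨Sum.inl i₀⟩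
    exact_mod_cast Fintype.card_pos
  set c := (δ₀ / d) ^ (d - 1) with hc
  have hc0 : 0 < c := by positivity
  set τ := min c (η * c) with hτ
  have hτ0 : 0 < τ := by positivity
  set T := 2 / τ ^ (d - 1) with hT
  have hT0 : 0 < T := by positivity
  refine ⟨c, hc0, max T τ, by positivity, fun Q hQ => ?_⟩
  have hQ0 : 0 < Q := by linarith
  have hpos : ∀ i, 0 < Q ^ ((m : ℝ) * k i) := fun i => Real.rpow_pos_of_pos hQ0 _
  have hdet := abs_det_transposedFormsMatrix (Θ := Θ) hk hQ0
  obtain ⟨z, hz0, hz⟩ := exists_int_ne_zero_abs_mulVec_lt (transposedFormsMatrix k Θ Q)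
    (by rw [← abs_pos, hdet]; exact one_pos) (Function.update (fun _ => τ) (Sum.inl i₀) T)
    (by intro a; by_cases ha : a = Sum.inl i₀
        · subst ha; simpa using hT0
        · simpa [ha] using hτ0)
    (by
      rw [hdet, Finset.prod_update_of_mem (Finset.mem_univ _), Finset.prod_const,
        Finset.card_sdiff, Finset.inter_univ, Finset.card_singleton, Finset.card_univ, ← hd, hT,
        div_mul_cancel₀ _ (by positivity)]
      norm_num)
  have hz' : ∀ a, a ≠ Sum.inl i₀ →
      |(transposedFormsMatrix k Θ Q).mulVec (fun b => (z b : ℝ)) a| < τ := fun a ha => by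
    simpa [ha] using hz a
  have hT' : |(transposedFormsMatrix k Θ Q).mulVec (fun b => (z b : ℝ)) (Sum.inl i₀)| < T := by
    simpa using hz (Sum.inl i₀)
  have hall : ∀ a, |(transposedFormsMatrix k Θ Q).mulVec (fun b => (z b : ℝ)) a| ≤ max T τ := by
    intro a
    by_cases ha : a = Sum.inl i₀
    · subst ha; exact hT'.le.trans (le_max_left _ _)
    · exact (hz' a ha).le.trans (le_max_right _ _)
  obtain ⟨a, ha⟩ := exists_le_abs_mulVec_of_dual (transposedFormsMatrix k Θ Q) (formsMatrix k Θ Q)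
    (transpose_transposedFormsMatrix_mul_formsMatrix hQ0) (abs_det_formsMatrix hk hQ0)
    (δ := δ₀ / d) (by positivity)
    (fun w hw => by
      rw [mul_div_cancel₀ _ hd0.ne']
      exact hδ Q hQ w hw) z hz0
  have ha0 : a = Sum.inl i₀ := by
    by_contra hne
    linarith [hz' a hne, min_le_left c (η * c)]
  subst ha0
  rw [← hd, ← hc, transposedFormsMatrix_mulVec_inl, abs_mul, abs_inv, abs_of_pos (hpos _),
    inv_mul_eq_div, le_div_iff₀ (hpos _)] at ha
  refine ⟨fun i => z (Sum.inl i), ha, fun i => ?_, fun i hi => ?_, fun j => ⟨z (Sum.inr j), ?_⟩⟩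
  · have := hall (Sum.inl i)
    rwa [transposedFormsMatrix_mulVec_inl, abs_mul, abs_inv, abs_of_pos (hpos _),
      inv_mul_eq_div, div_le_iff₀ (hpos _)] at this
  · have h1 := hz' (Sum.inl i) (by simpa using hi)
    rw [transposedFormsMatrix_mulVec_inl, abs_mul, abs_inv, abs_of_pos (hpos _),
      inv_mul_eq_div, div_lt_iff₀ (hpos _)] at h1
    have h2 : Q ^ ((m : ℝ) * k i) ≤ Q ^ ((m : ℝ) * k i₀) :=
      Real.rpow_le_rpow_of_exponent_le hQ (mul_le_mul_of_nonneg_left (hk1 i) (Nat.cast_nonneg _))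
    calc |(z (Sum.inl i) : ℝ)| ≤ τ * Q ^ ((m : ℝ) * k i) := h1.le
      _ ≤ (η * c) * Q ^ ((m : ℝ) * k i₀) := by
          gcongr
          exact min_le_right _ _
      _ = η * (c * Q ^ ((m : ℝ) * k i₀)) := by ring
      _ ≤ _ := by gcongr
  · have := hall (Sum.inr j)
    rw [transposedFormsMatrix_mulVec_inr, abs_mul, abs_of_pos hQ0] at this
    rwa [le_div_iff₀ hQ0, mul_comm]

/-- Points whose pairings with a suitable sequence of dual approximations avoid the integers are
badly approximable in the twisted sense. -/
theorem mem_badT_of_dual_sequence (hn : 0 < n) (hk : IsWeight k) {A C : ℝ} (hA : 1 < A)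
    (hC : 0 < C) (u : ℕ → Fin n → ℤ)
    (hu : ∀ t i, |(u t i : ℝ)| ≤ C * (A ^ (t + 1)) ^ ((m : ℝ) * k i))
    (hdual : ∀ t j, ∃ p : ℤ, |dualForm Θ (u t) j - p| ≤ C / A ^ (t + 1)) (x : Fin n → ℝ)
    (hx : ∀ t, ∀ p : ℤ, 1 / 4 ≤ |∑ i, (u t i : ℝ) * x i - p|) : x ∈ BadT n m k Θ := by
  set K := 8 * m * C + 1 with hK
  have hK0 : 1 ≤ K := by
    have : 0 ≤ 8 * m * C := by positivity
    linarith
  set W := ∑ i, C * (A * K) ^ ((m : ℝ) * k i) with hW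
  have hA0 : 0 < A := by linarith
  have : Nonempty (Fin n) := ⟨⟨0, hn⟩⟩
  have hW0 : 0 < W := Finset.sum_pos (fun i _ => by positivity) Finset.univ_nonempty
  refine ⟨1 / 8 / W, by positivity, fun q hq => ?_⟩
  have hq1 := one_le_supNorm hq
  set s := supNorm q with hs
  obtain ⟨t, ht, ht'⟩ := exists_nat_pow_near (show 1 ≤ K * s by nlinarith) hA
  choose p hp using hdual t
  set r : Fin n → ℝ := fun i => linForm Θ q i - x i - round (linForm Θ q i - x i) with hr
  set e : Fin m → ℝ := fun j => dualForm Θ (u t) j - p j with he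
  have hid : ∑ i, (u t i : ℝ) * x i -
      ((∑ j, q j * p j - ∑ i, u t i * round (linForm Θ q i - x i) : ℤ) : ℝ) =
      ∑ j, (q j : ℝ) * e j - ∑ i, (u t i : ℝ) * r i := by
    have h1 : ∑ i, (u t i : ℝ) * linForm Θ q i = ∑ j, (q j : ℝ) * dualForm Θ (u t) j := by
      simp only [linForm, dualForm, Finset.mul_sum]
      rw [Finset.sum_comm]
      exact Finset.sum_congr rfl fun j _ => Finset.sum_congr rfl fun i _ => by ring
    simp only [he, hr, mul_sub, Finset.sum_sub_distrib]
    push_cast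
    rw [h1]
    ring
  have h1 := hx t (∑ j, q j * p j - ∑ i, u t i * round (linForm Θ q i - x i))
  rw [hid] at h1
  have h2 : |∑ j, (q j : ℝ) * e j| ≤ 1 / 8 := by
    calc |∑ j, (q j : ℝ) * e j| ≤ ∑ j, |(q j : ℝ) * e j| := Finset.abs_sum_le_sum_abs _ _
      _ ≤ ∑ _j : Fin m, s * (C / A ^ (t + 1)) := by
          refine Finset.sum_le_sum fun j _ => ?_
          rw [abs_mul]
          exact mul_le_mul (abs_le_supNorm q j) (hp j) (abs_nonneg _) (by linarith)
      _ = m * C * s / A ^ (t + 1) := by simp; ring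
      _ ≤ 1 / 8 := by
          rw [div_le_iff₀ (by positivity)]
          nlinarith
  set S := ⨆ i, s ^ ((m : ℝ) * k i) * distNearestInt (linForm Θ q i - x i) with hS
  have h3 : |∑ i, (u t i : ℝ) * r i| ≤ W * S := by
    refine (Finset.abs_sum_le_sum_abs _ _).trans ?_
    rw [hW, Finset.sum_mul]
    refine Finset.sum_le_sum fun i _ => ?_
    have h4 : s ^ ((m : ℝ) * k i) * |r i| ≤ S := by
      rw [hr, ← distNearestInt_eq_abs_sub_round]
      exact le_ciSup (f := fun i => s ^ ((m : ℝ) * k i) * distNearestInt (linForm Θ q i - x i))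
        (Set.finite_range _).bddAbove i
    have hmk : 0 ≤ (m : ℝ) * k i := mul_nonneg (Nat.cast_nonneg _) (hk.1 i).le
    have h5 : (A ^ (t + 1)) ^ ((m : ℝ) * k i) ≤ (A * K) ^ ((m : ℝ) * k i) * s ^ ((m : ℝ) * k i) := by
      rw [← Real.mul_rpow (by positivity) (by positivity)]
      refine Real.rpow_le_rpow (by positivity) ?_ hmk
      rw [pow_succ]
      nlinarith
    rw [abs_mul]
    calc |(u t i : ℝ)| * |r i|
        ≤ (C * ((A * K) ^ ((m : ℝ) * k i) * s ^ ((m : ℝ) * k i))) * |r i| := by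
          gcongr
          exact (hu t i).trans (by gcongr)
      _ = (C * (A * K) ^ ((m : ℝ) * k i)) * (s ^ ((m : ℝ) * k i) * |r i|) := by ring
      _ ≤ _ := by gcongr
  have h6 := abs_sub (∑ j, (q j : ℝ) * e j) (∑ i, (u t i : ℝ) * r i)
  rw [div_le_iff₀ hW0]
  linarith

end FormsMatrix

theorem exists_separated_preimages {g : ℝ → ℝ} {l₁ l₂ α x y : ℝ} {N : ℕ} (hα : 0 < α)
    (hl₂ : 0 < l₂) (hx : x ≤ y) (hl : y + l₂ ≤ l₁)
    (hlow : N + 1 ≤ |g y - g x|) (hαl : α * l₂ ≤ 1 / 4)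
    (hup : ∀ s ∈ Set.Icc x l₁, ∀ s' ∈ Set.Icc x l₁, |g s - g s'| ≤ α * |s - s'|) :
    ∃ v : Fin N → ℝ,
      (∀ i, Set.Icc (v i) (v i + l₂) ⊆
        Set.Icc x l₁ ∩ {s | ∀ p : ℤ, 1 / 4 ≤ |g s - p|}) ∧
      ∀ i j, i ≠ j → 2 * l₂ ≤ |v i - v j| := by
  have hcont : ContinuousOn g (Set.uIcc x y) := by
    rw [Set.uIcc_of_le hx]
    have : LipschitzOnWith α.toNNReal g (Set.Icc x y) :=
      LipschitzOnWith.of_dist_le_mul fun s hs s' hs' => by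
        rw [Real.dist_eq, Real.dist_eq, Real.coe_toNNReal _ hα.le]
        exact hup s ⟨hs.1, by linarith [hs.2]⟩ s' ⟨hs'.1, by linarith [hs'.2]⟩
    exact this.continuousOn
  have hivt := intermediate_value_uIcc hcont
  set μ : ℤ := ⌈min (g x) (g y)⌉ with hμ
  have hmax : |g y - g x| = max (g x) (g y) - min (g x) (g y) := by
    rw [max_sub_min_eq_abs]
  have hmem : ∀ i : Fin N, ((μ : ℝ) + (i : ℕ) + 1 / 2) ∈ Set.uIcc (g x) (g y) := by
    intro i
    have h1 := Int.le_ceil (min (g x) (g y))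
    have h2 := Int.ceil_lt_add_one (min (g x) (g y))
    have h3 : ((i : ℕ) : ℝ) + 1 ≤ N := by exact_mod_cast i.2
    have h4 : (0 : ℝ) ≤ ((i : ℕ) : ℝ) := Nat.cast_nonneg _
    exact ⟨by linarith, by linarith⟩
  choose v hv hgv using fun i => hivt (hmem i)
  rw [Set.uIcc_of_le hx] at hv
  have hvI : ∀ i, v i ∈ Set.Icc x l₁ := fun i => ⟨(hv i).1, by linarith [(hv i).2]⟩
  refine ⟨v, fun i s hs => ?_, fun i j hij => ?_⟩
  · have hsI : s ∈ Set.Icc x l₁ :=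
      ⟨(hv i).1.trans hs.1, by linarith [(hv i).2, hs.2]⟩
    refine ⟨hsI, fun p => ?_⟩
    have h1 : |g s - g (v i)| ≤ 1 / 4 := by
      refine (hup s hsI _ (hvI i)).trans ?_
      rw [abs_of_nonneg (by linarith [hs.1])]
      nlinarith [hs.2]
    have h2 : (1 : ℝ) / 2 ≤ |g (v i) - p| := by
      rw [hgv]
      rcases le_or_gt p (μ + (i : ℕ)) with h | h
      · have : (p : ℝ) ≤ μ + (i : ℕ) := by exact_mod_cast h
        exact le_abs.2 (Or.inl (by linarith))
      · have : (μ : ℝ) + (i : ℕ) + 1 ≤ p := by exact_mod_cast h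
        exact le_abs.2 (Or.inr (by linarith))
    have h3 := abs_sub_le (g (v i)) (g s) p
    rw [abs_sub_comm (g (v i)) (g s)] at h3
    linarith
  · have h1 := hup _ (hvI i) _ (hvI j)
    rw [hgv, hgv, show (μ : ℝ) + (i : ℕ) + 1 / 2 - (μ + (j : ℕ) + 1 / 2) =
      (((i : ℕ) - (j : ℕ) : ℤ) : ℝ) by push_cast; ring] at h1
    have h2 : (1 : ℝ) ≤ |(((i : ℕ) - (j : ℕ) : ℤ) : ℝ)| := by
      have : ((i : ℕ) - (j : ℕ) : ℤ) ≠ 0 := by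
        intro h
        exact hij (Fin.ext (by omega))
      exact_mod_cast Int.one_le_abs this
    have h3 : α * (2 * l₂) ≤ α * |v i - v j| := by linarith
    exact le_of_mul_le_mul_left h3 hα

theorem le_dimH_of_lacunary {a b c₁ c₂ B l : ℝ} (hc₁ : 0 < c₁) (hc₂ : 0 < c₂)
    (hl : 0 < l) (hlab : l ≤ b - a) (hlc : c₂ * l ≤ 1 / 4) (hB : 2 ≤ B) (N : ℕ) (hN : 2 ≤ N)
    (hNB : N + 1 ≤ c₁ * l * B / 2) (g : ℕ → ℝ → ℝ)
    (hlow : ∀ t, ∀ s ∈ Set.Icc a b, ∀ s' ∈ Set.Icc a b,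
      c₁ * B ^ (t + 1) * |s - s'| ≤ |g t s - g t s'|)
    (hup : ∀ t, ∀ s ∈ Set.Icc a b, ∀ s' ∈ Set.Icc a b,
      |g t s - g t s'| ≤ c₂ * B ^ (t + 1) * |s - s'|) :
    ENNReal.ofReal (Real.log N / Real.log B) ≤
      dimH {s ∈ Set.Icc a b | ∀ t, ∀ p : ℤ, 1 / 4 ≤ |g t s - p|} := by
  have hB0 : 0 < B := by linarith
  have hsubab : Set.Icc a (a + l) ⊆ Set.Icc a b := Set.Icc_subset_Icc le_rfl (by linarith)
  refine (le_dimH_of_separated_children N hN B (by linarith) l hl a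
    (fun t => {s | ∀ p : ℤ, 1 / 4 ≤ |g t s - p|}) fun t x hx => ?_).trans (dimH_mono ?_)
  · have hsub := hx.trans hsubab
    have hl' : l / B ^ (t + 1) = l / B ^ t / B := by rw [pow_succ, div_div]
    have hlt : 0 < l / B ^ t := by positivity
    have hlt' : l / B ^ (t + 1) ≤ l / B ^ t / 2 := by
      rw [hl']; gcongr
    have hl0 : 0 < l / B ^ (t + 1) := by positivity
    refine exists_separated_preimages (α := c₂ * B ^ (t + 1))
      (y := x + l / B ^ t - l / B ^ (t + 1)) (by positivity) hl0 (by linarith) (by linarith) ?_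
      ?_ fun s hs s' hs' => hup t s (hsub hs) s' (hsub hs')
    · refine hNB.trans (le_trans ?_
        (hlow t _ (hsub ⟨by linarith, by linarith⟩) _ (hsub ⟨le_rfl, by linarith⟩)))
      rw [abs_of_nonneg (by linarith)]
      calc c₁ * l * B / 2 = c₁ * B ^ (t + 1) * (l / B ^ t / 2) := by
            rw [pow_succ]; field_simp
        _ ≤ _ := by
            gcongr
            linarith
    · calc c₂ * B ^ (t + 1) * (l / B ^ (t + 1)) = c₂ * l := by field_simp
        _ ≤ _ := hlc
  · rintro s ⟨hs, hsG⟩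
    exact ⟨hsubab hs, fun t => Set.mem_iInter.1 hsG t⟩

theorem dimH_le_dimH_image_of_mul_abs_sub_le {g : ℝ → ℝ} {E : Set ℝ} {c : ℝ} (hc : 0 < c)
    (h : ∀ s ∈ E, ∀ s' ∈ E, c * |s - s'| ≤ |g s - g s'|) : dimH E ≤ dimH (g '' E) := by
  have hinj : Set.InjOn g E := fun s hs s' hs' hss => by
    have := h s hs s' hs'
    rw [hss, sub_self, abs_zero] at this
    exact sub_eq_zero.1 (abs_nonpos_iff.1 (nonpos_of_mul_nonpos_right this hc))
  have hlip : LipschitzOnWith (c⁻¹).toNNReal (Function.invFunOn g E) (g '' E) := by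
    refine LipschitzOnWith.of_dist_le_mul ?_
    rintro _ ⟨s, hs, rfl⟩ _ ⟨s', hs', rfl⟩
    rw [hinj.leftInvOn_invFunOn hs, hinj.leftInvOn_invFunOn hs', Real.dist_eq, Real.dist_eq,
      Real.coe_toNNReal _ (by positivity), inv_mul_eq_div, le_div_iff₀ hc, mul_comm]
    exact h s hs s' hs'
  have := hlip.dimH_image_le
  rwa [hinj.leftInvOn_invFunOn.image_image] at this

/-- A linear combination of the coordinates of a curve whose `i₀`-th coefficient dominates is
bi-Lipschitz along the curve. -/
theorem abs_sum_mul_sub_bounds {n : ℕ} {f f' : ℝ → Fin n → ℝ} {a b : ℝ}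
    (hderiv : ∀ x ∈ Set.Icc a b, HasDerivWithinAt f (f' x) (Set.Icc a b) x)
    (i₀ : Fin n) {κ D η : ℝ} (hη : n * η * D ≤ κ / 2) (hη0 : 0 ≤ η)
    (hκ : ∀ x ∈ Set.Icc a b, κ ≤ |f' x i₀|) (hD : ∀ x ∈ Set.Icc a b, ∀ i, |f' x i| ≤ D)
    (u : Fin n → ℝ) (hu : ∀ i, i ≠ i₀ → |u i| ≤ η * |u i₀|) :
    ∀ s ∈ Set.Icc a b, ∀ s' ∈ Set.Icc a b,
      κ / 2 * |u i₀| * |s - s'| ≤ |∑ i, u i * f s i - ∑ i, u i * f s' i| ∧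
      |∑ i, u i * f s i - ∑ i, u i * f s' i| ≤ (∑ i, |u i| * D) * |s - s'| := by
  have key : ∀ s ∈ Set.Icc a b, ∀ s' ∈ Set.Icc a b, s < s' →
      κ / 2 * |u i₀| * |s' - s| ≤ |∑ i, u i * f s' i - ∑ i, u i * f s i| ∧
      |∑ i, u i * f s' i - ∑ i, u i * f s i| ≤ (∑ i, |u i| * D) * |s' - s| := by
    intro s hs s' hs' hss
    have hsub : Set.Icc s s' ⊆ Set.Icc a b := Set.Icc_subset_Icc hs.1 hs'.2
    have hg : ∀ x ∈ Set.Icc a b,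
        HasDerivWithinAt (fun x => ∑ i, u i * f x i) (∑ i, u i * f' x i) (Set.Icc a b) x :=
      fun x hx => HasDerivWithinAt.fun_sum fun i _ =>
        (hasDerivWithinAt_pi.1 (hderiv x hx) i).const_mul (u i)
    obtain ⟨ξ, hξ, hslope⟩ := exists_hasDerivAt_eq_slope (fun x => ∑ i, u i * f x i)
      (fun x => ∑ i, u i * f' x i) hss
      (fun x hx => ((hg x (hsub hx)).continuousWithinAt).mono hsub)
      (fun x hx => (hg x (hsub (Set.Ioo_subset_Icc_self hx))).hasDerivAt
        (Icc_mem_nhds (hs.1.trans_lt hx.1) (hx.2.trans_le hs'.2)))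
    have hξI : ξ ∈ Set.Icc a b := hsub (Set.Ioo_subset_Icc_self hξ)
    rw [eq_div_iff (by linarith)] at hslope
    rw [← hslope, abs_mul]
    have hup : |∑ i, u i * f' ξ i| ≤ ∑ i, |u i| * D := by
      refine (Finset.abs_sum_le_sum_abs _ _).trans (Finset.sum_le_sum fun i _ => ?_)
      rw [abs_mul]
      exact mul_le_mul_of_nonneg_left (hD ξ hξI i) (abs_nonneg _)
    have hlow : κ / 2 * |u i₀| ≤ |∑ i, u i * f' ξ i| := by
      have hD0 : 0 ≤ D := (abs_nonneg _).trans (hD ξ hξI i₀)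
      rw [← Finset.add_sum_erase _ _ (Finset.mem_univ i₀)]
      have h1 : |∑ i ∈ Finset.univ.erase i₀, u i * f' ξ i| ≤ n * η * D * |u i₀| := by
        calc |∑ i ∈ Finset.univ.erase i₀, u i * f' ξ i|
            ≤ ∑ i ∈ Finset.univ.erase i₀, |u i * f' ξ i| := Finset.abs_sum_le_sum_abs _ _
          _ ≤ ∑ i ∈ Finset.univ.erase i₀, η * |u i₀| * D := by
              refine Finset.sum_le_sum fun i hi => ?_
              rw [abs_mul]
              exact mul_le_mul (hu i (Finset.ne_of_mem_erase hi)) (hD ξ hξI i) (abs_nonneg _)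
                (by positivity)
          _ ≤ ∑ _i : Fin n, η * |u i₀| * D :=
              Finset.sum_le_sum_of_subset_of_nonneg (Finset.erase_subset _ _)
                fun _ _ _ => by positivity
          _ = _ := by simp; ring
      have h2 : κ * |u i₀| ≤ |u i₀ * f' ξ i₀| := by
        rw [abs_mul, mul_comm]
        exact mul_le_mul_of_nonneg_left (hκ ξ hξI) (abs_nonneg _)
      have h3 := abs_sub_abs_le_abs_add (u i₀ * f' ξ i₀) (∑ i ∈ Finset.univ.erase i₀, u i * f' ξ i)
      have h4 := mul_le_mul_of_nonneg_right hη (abs_nonneg (u i₀))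
      linarith
    exact ⟨mul_le_mul_of_nonneg_right hlow (abs_nonneg _),
      mul_le_mul_of_nonneg_right hup (abs_nonneg _)⟩
  intro s hs s' hs'
  rcases lt_trichotomy s s' with h | h | h
  · rw [abs_sub_comm s s', abs_sub_comm (∑ i, u i * f s i)]
    exact key s hs s' hs' h
  · simp [h]
  · exact key s' hs' s hs h

theorem tendsto_ofReal_one_add_div_log (c : ℝ) :
    Filter.Tendsto (fun B : ℝ => ENNReal.ofReal (1 + c / Real.log B)) Filter.atTop (𝓝 1) := by
  have h : Filter.Tendsto (fun B : ℝ => 1 + c / Real.log B) Filter.atTop (𝓝 (1 + 0)) :=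
    tendsto_const_nhds.add (Real.tendsto_log_atTop.const_div_atTop c)
  simpa [Function.comp_def] using (ENNReal.continuous_ofReal.tendsto _).comp h

/-- (Theorem 3, Hausdorff-dimension consequence.) If
`k₁ = max kᵢ`, `Θ ∈ Bad(k,n,m)` and `C` is an everywhere non-degenerate `C¹` curve,
then the projection of `Bad_Θ(k,n,m) ∩ C` onto the first coordinate has Hausdorff
dimension 1. -/
theorem projection_badT_inter_curve_dimH {n m : ℕ} (hn : 0 < n) (hm : 0 < m)
    (k : Fin n → ℝ) (hk : IsWeight k) (hk1 : ∀ i, k i ≤ k ⟨0, hn⟩)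
    (Θ : Matrix (Fin n) (Fin m) ℝ) (hΘ : Θ ∈ Bad n m k)
    (a b : ℝ) (hab : a < b)
    (f f' : ℝ → Fin n → ℝ)
    (hderiv : ∀ x ∈ Set.Icc a b, HasDerivWithinAt f (f' x) (Set.Icc a b) x)
    (hcont : ContinuousOn f' (Set.Icc a b))
    (hnd : ∀ x ∈ Set.Icc a b, ∀ i, f' x i ≠ 0) :
    dimH ((fun x : Fin n → ℝ => x ⟨0, hn⟩) '' (BadT n m k Θ ∩ f '' Set.Icc a b)) = 1 := by
  refine le_antisymm ((dimH_mono (Set.subset_univ _)).trans Real.dimH_univ.le) ?_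
  set i₀ : Fin n := ⟨0, hn⟩ with hi₀
  have hne : (Set.Icc a b).Nonempty := Set.nonempty_Icc.2 hab.le
  have hcont' : ∀ i, ContinuousOn (fun x => |f' x i|) (Set.Icc a b) := fun i =>
    ((continuous_apply i).comp_continuousOn hcont).abs
  obtain ⟨x₁, hx₁, hmin⟩ := isCompact_Icc.exists_isMinOn hne (hcont' i₀)
  set κ := |f' x₁ i₀| with hκ
  have hκ0 : 0 < κ := abs_pos.2 (hnd x₁ hx₁ i₀)
  have hκle : ∀ x ∈ Set.Icc a b, κ ≤ |f' x i₀| := fun x hx => hmin hx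
  obtain ⟨D, hD⟩ : ∃ D, ∀ x ∈ Set.Icc a b, ∀ i, |f' x i| ≤ D := by
    obtain ⟨D, hD⟩ := isCompact_Icc.exists_bound_of_continuousOn hcont
    exact ⟨D, fun x hx i => (norm_le_pi_norm (f' x) i).trans (hD x hx)⟩
  have hD0 : 0 < D := hκ0.trans_le (hD x₁ hx₁ i₀)
  have hn0 : (0 : ℝ) < n := by exact_mod_cast hn
  have hm0 : (0 : ℝ) < m := by exact_mod_cast hm
  set η := κ / 2 / (n * D) with hη
  have hη0 : 0 < η := by positivity
  have hηD : n * η * D ≤ κ / 2 := by rw [hη]; field_simp; rfl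
  obtain ⟨c, hc, C, hC, happrox⟩ := exists_dual_approximation hn hk i₀ hk1 hΘ hη0
  set e := (m : ℝ) * k i₀ with he
  have he0 : 0 < e := mul_pos hm0 (hk.1 i₀)
  set c₁ := κ / 2 * c with hc₁
  have hc₁0 : 0 < c₁ := by positivity
  set c₂ := n * C * D with hc₂
  have hc₂0 : 0 < c₂ := by positivity
  set l := min (b - a) (1 / (4 * c₂)) with hl
  have hl0 : 0 < l := lt_min (by linarith) (by positivity)
  have hlc : c₂ * l ≤ 1 / 4 := by
    calc c₂ * l ≤ c₂ * (1 / (4 * c₂)) := by gcongr; exact min_le_right _ _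
      _ = 1 / 4 := by field_simp
  set ρ := c₁ * l / 4 with hρ
  have hρ0 : 0 < ρ := by positivity
  refine le_of_tendsto (tendsto_ofReal_one_add_div_log (Real.log (ρ / 2))) ?_
  filter_upwards [Filter.eventually_ge_atTop (2 : ℝ), Filter.eventually_ge_atTop (2 / ρ)]
    with B hB hBρ
  have hB0 : 0 < B := by linarith
  have hBρ' : 2 ≤ ρ * B := by rwa [div_le_iff₀' hρ0] at hBρ
  set A := B ^ (1 / e) with hA
  have hA1 : 1 < A := Real.one_lt_rpow (by linarith) (by positivity)
  have hA0 : 0 < A := by linarith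
  have hAe : ∀ t : ℕ, (A ^ t) ^ e = B ^ t := fun t => by
    rw [hA, ← Real.rpow_natCast, ← Real.rpow_mul hB0.le, ← Real.rpow_mul hB0.le,
      show 1 / e * (t : ℝ) * e = t by field_simp, Real.rpow_natCast]
  choose u hu₁ hu₂ hu₃ hu₄ using fun t : ℕ => happrox (A ^ (t + 1)) (one_le_pow₀ hA1.le)
  have hbounds := fun t => abs_sum_mul_sub_bounds hderiv i₀ hηD hη0.le hκle hD
    (fun i => (u t i : ℝ)) (hu₃ t)
  have hle : ∀ t i, |(u t i : ℝ)| ≤ C * B ^ (t + 1) := fun t i => by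
    refine (hu₂ t i).trans ?_
    rw [← hAe]
    gcongr
    · exact one_le_pow₀ hA1.le
    · exact mul_le_mul_of_nonneg_left (hk1 i) hm0.le
  set E := {s ∈ Set.Icc a b | ∀ t, ∀ p : ℤ, 1 / 4 ≤ |∑ i, (u t i : ℝ) * f s i - p|} with hE
  set N := ⌊ρ * B⌋₊ with hN
  have hNle : (N : ℝ) ≤ ρ * B := Nat.floor_le (by positivity)
  have hNlt : ρ * B < N + 1 := Nat.lt_floor_add_one _
  have hdimE : ENNReal.ofReal (Real.log N / Real.log B) ≤ dimH E := by
    refine le_dimH_of_lacunary hc₁0 hc₂0 hl0 (min_le_left _ _) hlc hB N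
      (Nat.le_floor (by exact_mod_cast hBρ')) ?_ (fun t s => ∑ i, (u t i : ℝ) * f s i) ?_ ?_
    · rw [show c₁ * l * B / 2 = 2 * (ρ * B) by rw [hρ]; ring]
      linarith
    · intro t s hs s' hs'
      refine le_trans ?_ (hbounds t s hs s' hs').1
      have := hu₁ t
      rw [hAe] at this
      rw [hc₁, mul_assoc (κ / 2)]
      gcongr
    · intro t s hs s' hs'
      refine (hbounds t s hs s' hs').2.trans ?_
      gcongr
      calc ∑ i, |(u t i : ℝ)| * D ≤ ∑ _i : Fin n, C * B ^ (t + 1) * D :=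
            Finset.sum_le_sum fun i _ => by gcongr; exact hle t i
        _ = c₂ * B ^ (t + 1) := by simp [hc₂]; ring
  have hlog : 1 + Real.log (ρ / 2) / Real.log B ≤ Real.log N / Real.log B := by
    have hlogB : 0 < Real.log B := Real.log_pos (by linarith)
    rw [← div_self hlogB.ne', ← add_div, ← Real.log_mul hB0.ne' (by positivity)]
    gcongr
    linarith
  have hproj : dimH E ≤ dimH ((fun s => f s i₀) '' E) := by
    refine dimH_le_dimH_image_of_mul_abs_sub_le (c := κ / 2) (by positivity) fun s hs s' hs' => ?_
    have := (abs_sum_mul_sub_bounds hderiv i₀ hηD hη0.le hκle hD (Pi.single i₀ 1)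
      (fun i hi => by simpa [hi] using hη0.le) s hs.1 s' hs'.1).1
    simpa [Pi.single_apply] using this
  refine (ENNReal.ofReal_le_ofReal hlog).trans (hdimE.trans (hproj.trans (dimH_mono ?_)))
  rintro _ ⟨s, hs, rfl⟩
  exact ⟨f s, ⟨mem_badT_of_dual_sequence hn hk hA1 hC u hu₂ hu₄ (f s) hs.2, s, hs.1, rfl⟩, rfl⟩
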